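/- There exists a vector f ∈ ℓ² that is simultaneously hypercyclic for every operator λB with real λ > 1, where B is the backward shift; i.e., for each λ > 1 the orbit {(λB)ⁿ f : n ≥ 0} is dense in ℓ². -/

import Mathlib

open Filter Topology

theorem sum_pow_succ_le_two_mul {q : ℝ} (hq : 0 ≤ q) (hq' : q ≤ 1 / 2) (r : ℕ) :
    ∑ x ∈ Finset.range r, q ^ (x + 1) ≤ 2 * q := by
  have h := geom_sum_mul_neg q r
  have hs : 0 ≤ ∑ x ∈ Finset.range r, q ^ x := Finset.sum_nonneg fun _ _ => by positivity
  have hr : 0 ≤ q ^ r := by positivity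
  have h2 : ∑ x ∈ Finset.range r, q ^ x ≤ 2 := by nlinarith
  simp only [pow_succ]
  rw [← Finset.sum_mul]
  exact mul_le_mul_of_nonneg_right h2 hq

theorem norm_iterate_le {E : Type*} [NormedAddCommGroup E] {S : E → E}
    (hS : ∀ x, ‖S x‖ ≤ ‖x‖) (n : ℕ) (x : E) :
    ‖S^[n] x‖ ≤ ‖x‖ := by
  induction n with
  | zero => simp
  | succ n ih => rw [Function.iterate_succ_apply']; exact (hS _).trans ih

section RightInverse

variable {E : Type*} [NormedAddCommGroup E] [NormedSpace ℂ E] {B : E →L[ℂ] E} {S : E → E}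

theorem pow_apply_iterate_rightInverse (hS : ∀ x, B (S x) = x) (n : ℕ) (x : E) :
    (B ^ n) (S^[n] x) = x := by
  rw [FunLike.coe_pow_eq_iterate]
  exact Function.LeftInverse.iterate (f := S) (g := B) hS n x

theorem pow_apply_iterate_add (hS : ∀ x, B (S x) = x) (n k : ℕ) (x : E) :
    (B ^ n) (S^[n + k] x) = S^[k] x := by
  rw [Function.iterate_add_apply, pow_apply_iterate_rightInverse hS]

theorem pow_apply_eq_zero_of_le {m n : ℕ} (h : m ≤ n) {x : E} (hx : (B ^ m) x = 0) :
    (B ^ n) x = 0 := by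
  obtain ⟨k, rfl⟩ := Nat.exists_eq_add_of_le' h
  rw [pow_add, mul_apply_eq_comp, hx, map_zero]

end RightInverse

/-- A slowly growing sequence of scalars starting at `a`, with logarithmic increments
`η / (N * (i + 1))`. -/
noncomputable def harmonicGrid (a η : ℝ) (N i : ℕ) : ℝ :=
  a * Real.exp (η / N * ∑ k ∈ Finset.range i, 1 / ((k : ℝ) + 1))

theorem harmonicGrid_zero (a η : ℝ) (N : ℕ) : harmonicGrid a η N 0 = a := by
  simp [harmonicGrid]

theorem harmonicGrid_monotone {a η : ℝ} (ha : 0 ≤ a) (hη : 0 ≤ η) (N : ℕ) :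
    Monotone (harmonicGrid a η N) := by
  refine monotone_nat_of_le_succ fun i => ?_
  unfold harmonicGrid
  rw [Finset.sum_range_succ]
  gcongr
  have : (0 : ℝ) ≤ 1 / ((i : ℝ) + 1) := by positivity
  linarith

theorem harmonicGrid_succ_pow {a η : ℝ} {N : ℕ} (hN : N ≠ 0) (i : ℕ) :
    harmonicGrid a η N (i + 1) ^ (N * (i + 1)) =
      Real.exp η * harmonicGrid a η N i ^ (N * (i + 1)) := by
  have hN' : (N : ℝ) ≠ 0 := by exact_mod_cast hN
  have hi : (i : ℝ) + 1 ≠ 0 := by positivity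
  have : harmonicGrid a η N (i + 1) =
      Real.exp (η / (N * (i + 1))) * harmonicGrid a η N i := by
    unfold harmonicGrid
    rw [Finset.sum_range_succ, mul_add, Real.exp_add]
    have : η / N * (1 / ((i : ℝ) + 1)) = η / (N * (i + 1)) := by field_simp
    rw [this]
    ring
  rw [this, mul_pow, ← Real.exp_nat_mul]
  congr 2
  push_cast
  field_simp

theorem tendsto_harmonicGrid {a η : ℝ} {N : ℕ} (ha : 0 < a) (hη : 0 < η) (hN : N ≠ 0) :
    Tendsto (harmonicGrid a η N) atTop atTop := by
  have hN' : (0 : ℝ) < N := by exact_mod_cast Nat.pos_of_ne_zero hN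
  exact (Real.tendsto_exp_atTop.comp
    (Real.tendsto_sum_range_one_div_nat_succ_atTop.const_mul_atTop
      (div_pos hη hN'))).const_mul_atTop ha

section Density

variable {E : Type*} [NormedAddCommGroup E] [NormedSpace ℂ E] {B : E →L[ℂ] E} {S : E → E}

theorem norm_smul_iterate_le (hS' : ∀ x, ‖S x‖ ≤ ‖x‖) {a l : ℝ} (ha : 0 < a) (hl : a ≤ l)
    (N k n : ℕ) (y : E) :
    ‖((l⁻¹ ^ (N * k) : ℝ) : ℂ) • S^[n] y‖ ≤ (a⁻¹ ^ N) ^ k * ‖y‖ := by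
  have hl0 : 0 < l := ha.trans_le hl
  rw [norm_smul, Complex.norm_real, Real.norm_of_nonneg (by positivity), ← pow_mul]
  gcongr
  exact norm_iterate_le hS' n y

theorem exists_near_forall_mem_Icc_of_pow_eq_zero (hS : ∀ x, B (S x) = x)
    (hS' : ∀ x, ‖S x‖ ≤ ‖x‖) {g y : E} {m : ℕ} (hg : (B ^ m) g = 0) (hy : (B ^ m) y = 0)
    {a : ℝ} (ha : 1 < a) (b : ℝ) {ε : ℝ} (hε : 0 < ε) :
    ∃ f : E, ‖f - g‖ < ε ∧
      ∀ lam ∈ Set.Icc a b, ∃ n : ℕ, ‖((lam : ℂ) ^ n) • (B ^ n) f - y‖ < ε := by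
  have ha0 : 0 < a := zero_lt_one.trans ha
  obtain ⟨η, hη, hηε⟩ : ∃ η : ℝ, 0 < η ∧ (Real.exp η - 1) * ‖y‖ < ε / 2 := by
    have : Tendsto (fun η : ℝ => (Real.exp η - 1) * ‖y‖) (𝓝[>] 0) (𝓝 0) := by
      have h : Continuous (fun η : ℝ => (Real.exp η - 1) * ‖y‖) := by fun_prop
      simpa using (h.tendsto 0).mono_left nhdsWithin_le_nhds
    obtain ⟨η, h1, h2⟩ :=
      ((this.eventually_lt_const (half_pos hε)).and self_mem_nhdsWithin).exists
    exact ⟨η, h2, h1⟩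
  obtain ⟨N, hN0, hmN, hq2, hqε⟩ : ∃ N : ℕ, N ≠ 0 ∧ m ≤ N ∧ a⁻¹ ^ N ≤ 1 / 2 ∧
      2 * a⁻¹ ^ N * ‖y‖ < ε / 2 := by
    have h0 : Tendsto (fun N : ℕ => a⁻¹ ^ N) atTop (𝓝 0) :=
      tendsto_pow_atTop_nhds_zero_of_lt_one (by positivity) (inv_lt_one_of_one_lt₀ ha)
    have h1 : Tendsto (fun N : ℕ => 2 * a⁻¹ ^ N * ‖y‖) atTop (𝓝 0) := by
      simpa using (h0.const_mul 2).mul_const ‖y‖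
    obtain ⟨N, h2, h3, h4, h5⟩ := ((eventually_ne_atTop 0).and ((eventually_ge_atTop m).and
      ((h0.eventually_le_const (u := 1 / 2) (by norm_num)).and
        (h1.eventually_lt_const (half_pos hε))))).exists
    exact ⟨N, h2, h3, h4, h5⟩
  set q : ℝ := a⁻¹ ^ N with hq
  have hq0 : 0 ≤ q := by positivity
  set l := harmonicGrid a η N with hl
  have hmono : Monotone l := harmonicGrid_monotone ha0.le hη.le N
  have hal (i) : a ≤ l i := (harmonicGrid_zero a η N).ge.trans (hmono (Nat.zero_le i))
  obtain ⟨J, hJ⟩ := ((tendsto_harmonicGrid ha0 hη hN0).eventually_gt_atTop b).exists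
  have htail (r : ℕ) (u : ℕ → E) (hu : ∀ x, ‖u x‖ ≤ q ^ (x + 1) * ‖y‖) :
      ‖∑ x ∈ Finset.range r, u x‖ < ε / 2 := by
    refine lt_of_le_of_lt ((norm_sum_le_of_le _ fun x _ => hu x).trans ?_) hqε
    rw [← Finset.sum_mul]
    exact mul_le_mul_of_nonneg_right (sum_pow_succ_le_two_mul hq0 hq2 r) (norm_nonneg _)
  set t : ℕ → E := fun k => (((l k)⁻¹ ^ (N * (k + 1)) : ℝ) : ℂ) • S^[N * (k + 1)] y with ht
  refine ⟨g + ∑ k ∈ Finset.range J, t k, ?_, fun lam hlam => ?_⟩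
  · rw [add_sub_cancel_left]
    exact (htail J t fun x => norm_smul_iterate_le hS' ha0 (hal x) N (x + 1) _ y).trans
      (half_lt_self hε)
  · have hlam0 : 0 < lam := ha0.trans_le hlam.1
    obtain ⟨i, hiJ, hi1, hi2⟩ : ∃ i < J, l i ≤ lam ∧ lam < l (i + 1) := by
      have hex : ∃ k, lam < l k := ⟨J, hlam.2.trans_lt hJ⟩
      classical
      have hfind := Nat.find_spec hex
      have hpos : Nat.find hex ≠ 0 := fun h0 => by
        rw [h0, hl, harmonicGrid_zero] at hfind
        exact hfind.not_ge hlam.1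
      obtain ⟨i, hi⟩ := Nat.exists_eq_succ_of_ne_zero hpos
      refine ⟨i, ?_, not_lt.1 (Nat.find_min hex (m := i) (by omega)), by rwa [hi] at hfind⟩
      have := Nat.find_min' hex (hlam.2.trans_lt hJ)
      omega
    obtain ⟨r, rfl⟩ := Nat.exists_eq_add_of_le (Nat.succ_le_of_lt hiJ)
    refine ⟨N * (i + 1), ?_⟩
    set n := N * (i + 1) with hn
    have hmn : m ≤ n := hmN.trans (Nat.le_mul_of_pos_right N i.succ_pos)
    have hli : 0 < l i := ha0.trans_le (hal i)
    have hlow : ∑ k ∈ Finset.range i, (B ^ n) (t k) = 0 := by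
      refine Finset.sum_eq_zero fun k hk => ?_
      have hk' : k + 1 ≤ i := Finset.mem_range.1 hk
      have hsplit : n = N * (i - k) + N * (k + 1) := by
        rw [← mul_add, hn]; congr 1; omega
      have hmk : m ≤ N * (i - k) := hmN.trans (Nat.le_mul_of_pos_right N (by omega))
      rw [ht, map_smul, hsplit, pow_add, mul_apply_eq_comp,
        pow_apply_iterate_rightInverse hS, pow_apply_eq_zero_of_le hmk hy, smul_zero]
    have hmid : ‖((lam : ℂ) ^ n) • (B ^ n) (t i) - y‖ < ε / 2 := by
      have h1 : 1 ≤ (lam * (l i)⁻¹) ^ n := by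
        apply one_le_pow₀
        rw [← div_eq_mul_inv, one_le_div hli]
        exact hi1
      have h2 : (lam * (l i)⁻¹) ^ n ≤ Real.exp η := by
        rw [← div_eq_mul_inv, div_pow, div_le_iff₀ (by positivity),
          ← harmonicGrid_succ_pow hN0 i]
        exact pow_le_pow_left₀ hlam0.le hi2.le n
      have h3 : ((lam : ℂ) ^ n) • (B ^ n) (t i) - y =
          (((lam * (l i)⁻¹) ^ n - 1 : ℝ) : ℂ) • y := by
        rw [ht, map_smul, pow_apply_iterate_rightInverse hS, smul_smul, Complex.ofReal_sub,
          sub_smul, Complex.ofReal_one, one_smul, mul_pow]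
        push_cast
        rfl
      rw [h3, norm_smul, Complex.norm_real, Real.norm_of_nonneg (by linarith)]
      refine lt_of_le_of_lt ?_ hηε
      gcongr
    have hhigh : ‖∑ x ∈ Finset.range r, ((lam : ℂ) ^ n) • (B ^ n) (t (i + 1 + x))‖ < ε / 2 := by
      refine htail r _ fun x => ?_
      have hlx : lam ≤ l (i + 1 + x) := hi2.le.trans (hmono (Nat.le_add_right _ _))
      have hlx0 : 0 < l (i + 1 + x) := hlam0.trans_le hlx
      have hsplit : N * (i + 1 + x + 1) = n + N * (x + 1) := by rw [hn]; ring
      have h1 : (lam * (l (i + 1 + x))⁻¹) ^ n ≤ 1 := by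
        apply pow_le_one₀ (by positivity)
        rw [← div_eq_mul_inv, div_le_one hlx0]
        exact hlx
      have h2 : ((lam : ℂ) ^ n) • (B ^ n) (t (i + 1 + x)) =
          (((lam * (l (i + 1 + x))⁻¹) ^ n : ℝ) : ℂ) •
            ((((l (i + 1 + x))⁻¹ ^ (N * (x + 1)) : ℝ) : ℂ) • S^[N * (x + 1)] y) := by
        rw [ht, map_smul, hsplit, pow_apply_iterate_add hS, smul_smul, smul_smul]
        congr 1
        push_cast
        ring
      rw [h2, norm_smul, Complex.norm_real, Real.norm_of_nonneg (by positivity)]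
      exact (mul_le_of_le_one_left (norm_nonneg _) h1).trans
        (norm_smul_iterate_le hS' ha0 (hal _) N (x + 1) _ y)
    have hdecomp : ((lam : ℂ) ^ n) • (B ^ n) (g + ∑ k ∈ Finset.range (i + 1 + r), t k) - y =
        (((lam : ℂ) ^ n) • (B ^ n) (t i) - y) +
          ∑ x ∈ Finset.range r, ((lam : ℂ) ^ n) • (B ^ n) (t (i + 1 + x)) := by
      rw [map_add, pow_apply_eq_zero_of_le hmn hg, zero_add, map_sum, Finset.sum_range_add,
        Finset.sum_range_succ, hlow, zero_add, smul_add, Finset.smul_sum]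
      abel
    rw [hdecomp]
    calc _ ≤ _ := norm_add_le _ _
      _ < ε / 2 + ε / 2 := add_lt_add hmid hhigh
      _ = ε := add_halves ε

theorem isOpen_setOf_forall_exists_norm_lt (B : E →L[ℂ] E) {K : Set ℝ} (hK : IsCompact K)
    (y : E) (ε : ℝ) :
    IsOpen {f : E | ∀ lam ∈ K, ∃ n : ℕ, ‖((lam : ℂ) ^ n) • (B ^ n) f - y‖ < ε} := by
  rw [isOpen_iff_eventually]
  intro f hf
  refine hK.eventually_forall_of_forall_eventually fun lam hlam => ?_
  obtain ⟨n, hn⟩ := hf lam hlam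
  have hc : Continuous fun z : E × ℝ => ‖((z.2 : ℂ) ^ n) • (B ^ n) z.1 - y‖ := by fun_prop
  exact ((hc.tendsto (f, lam)).eventually_lt_const hn).mono fun z hz => ⟨n, hz⟩

theorem dense_setOf_forall_exists_norm_lt (hS : ∀ x, B (S x) = x) (hS' : ∀ x, ‖S x‖ ≤ ‖x‖)
    (hD : Dense {x : E | ∃ m : ℕ, (B ^ m) x = 0}) {a : ℝ} (ha : 1 < a) (b : ℝ) (y : E)
    {ε : ℝ} (hε : 0 < ε) :
    Dense {f : E | ∀ lam ∈ Set.Icc a b, ∃ n : ℕ,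
      ‖((lam : ℂ) ^ n) • (B ^ n) f - y‖ < ε} := by
  refine Metric.dense_iff.2 fun g δ hδ => ?_
  obtain ⟨g', hg', m₁, hm₁⟩ := Metric.dense_iff.1 hD g (δ / 2) (half_pos hδ)
  obtain ⟨y', hy', m₂, hm₂⟩ := Metric.dense_iff.1 hD y (ε / 2) (half_pos hε)
  obtain ⟨f, hf, hf'⟩ := exists_near_forall_mem_Icc_of_pow_eq_zero hS hS'
    (pow_apply_eq_zero_of_le (le_max_left m₁ m₂) hm₁)
    (pow_apply_eq_zero_of_le (le_max_right m₁ m₂) hm₂) ha b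
    (lt_min (half_pos hδ) (half_pos hε))
  rw [Metric.mem_ball, dist_eq_norm] at hg' hy'
  refine ⟨f, ?_, fun lam hlam => ?_⟩
  · rw [Metric.mem_ball, dist_eq_norm]
    have := norm_sub_le_norm_sub_add_norm_sub f g' g
    linarith [min_le_left (δ / 2) (ε / 2)]
  · obtain ⟨n, hn⟩ := hf' lam hlam
    refine ⟨n, ?_⟩
    have := norm_sub_le_norm_sub_add_norm_sub (((lam : ℂ) ^ n) • (B ^ n) f) y' y
    linarith [min_le_right (δ / 2) (ε / 2)]

/-- A bounded operator on a separable Banach space with a norm-nonincreasing right inverse and a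
dense generalized kernel has a hypercyclic vector common to all its multiples by `lam > 1`. -/
theorem exists_common_hypercyclic_vector [CompleteSpace E] [TopologicalSpace.SeparableSpace E]
    (hS : ∀ x, B (S x) = x) (hS' : ∀ x, ‖S x‖ ≤ ‖x‖)
    (hD : Dense {x : E | ∃ m : ℕ, (B ^ m) x = 0}) :
    ∃ f : E, ∀ lam : ℝ, 1 < lam → Dense (Set.range fun n : ℕ => (((lam : ℂ) • B) ^ n) f) := by
  have hbase : Dense (⋂ p : ℕ × ℕ × ℕ, {f : E | ∀ lam ∈
      Set.Icc (1 + 1 / ((p.1 : ℝ) + 1)) (p.1 : ℝ), ∃ n : ℕ,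
        ‖((lam : ℂ) ^ n) • (B ^ n) f - TopologicalSpace.denseSeq E p.2.1‖ <
          1 / ((p.2.2 : ℝ) + 1)}) := by
    refine dense_iInter_of_isOpen
      (fun p => isOpen_setOf_forall_exists_norm_lt B isCompact_Icc _ _) fun p => ?_
    refine dense_setOf_forall_exists_norm_lt hS hS' hD ?_ _ _ Nat.one_div_pos_of_nat
    linarith [Nat.one_div_pos_of_nat (α := ℝ) (n := p.1)]
  obtain ⟨f, hf⟩ := hbase.nonempty
  rw [Set.mem_iInter] at hf
  refine ⟨f, fun lam hlam => Metric.dense_iff.2 fun y ε hε => ?_⟩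
  obtain ⟨_, hy, j, rfl⟩ :=
    Metric.dense_iff.1 (TopologicalSpace.denseRange_denseSeq E) y (ε / 2) (half_pos hε)
  obtain ⟨k, hk⟩ := exists_nat_one_div_lt (half_pos hε)
  obtain ⟨i, hi⟩ := exists_nat_one_div_lt (sub_pos.2 hlam)
  obtain ⟨i', hi'⟩ := exists_nat_ge lam
  have hmem : lam ∈ Set.Icc (1 + 1 / (((max i i' : ℕ) : ℝ) + 1)) ((max i i' : ℕ) : ℝ) := by
    constructor
    · have : 1 / (((max i i' : ℕ) : ℝ) + 1) ≤ 1 / ((i : ℝ) + 1) :=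
        Nat.one_div_le_one_div (le_max_left i i')
      linarith
    · exact hi'.trans (by exact_mod_cast le_max_right i i')
  obtain ⟨n, hn⟩ := hf (max i i', j, k) lam hmem
  refine ⟨_, ?_, n, rfl⟩
  rw [Metric.mem_ball, dist_eq_norm] at hy ⊢
  beta_reduce
  rw [smul_pow]
  have := norm_sub_le_norm_sub_add_norm_sub (((lam : ℂ) ^ n) • (B ^ n) f)
    (TopologicalSpace.denseSeq E j) y
  simp only [smul_apply]
  linarith

end Density

/-- The sequence `0, x 0, x 1, …`. -/
def consZero (x : ℕ → ℂ) : ℕ → ℂ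
  | 0 => 0
  | n + 1 => x n

theorem memℓp_two_consZero (x : lp (fun _ : ℕ => ℂ) 2) :
    Memℓp (E := fun _ : ℕ => ℂ) (consZero x) 2 := by
  have h2 : (0 : ℝ) < (2 : ENNReal).toReal := by norm_num
  refine memℓp_gen ?_
  rw [← summable_nat_add_iff 1]
  exact (lp.memℓp x).summable h2

/-- The forward shift on `ℓ²`. -/
def forwardShift (x : lp (fun _ : ℕ => ℂ) 2) : lp (fun _ : ℕ => ℂ) 2 :=
  ⟨consZero x, memℓp_two_consZero x⟩

theorem norm_forwardShift (x : lp (fun _ : ℕ => ℂ) 2) : ‖forwardShift x‖ = ‖x‖ := by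
  have h2 : (0 : ℝ) < (2 : ENNReal).toReal := by norm_num
  rw [lp.norm_eq_tsum_rpow h2, lp.norm_eq_tsum_rpow h2,
    ((lp.memℓp (forwardShift x)).summable h2).tsum_eq_zero_add]
  simp [forwardShift, consZero]

theorem hasSum_single_two (x : lp (fun _ : ℕ => ℂ) 2) :
    HasSum (fun i => lp.single 2 i (x i)) x :=
  lp.hasSum_single (by norm_num) x

theorem separableSpace_lp_two : TopologicalSpace.SeparableSpace (lp (fun _ : ℕ => ℂ) 2) := by
  rw [← TopologicalSpace.isSeparable_univ_iff]
  have hs := ((Set.countable_range fun i : ℕ =>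
    (lp.single 2 i (1 : ℂ) : lp (fun _ : ℕ => ℂ) 2)).isSeparable.span (R := ℂ)).closure
  refine hs.mono fun x _ => ?_
  refine mem_closure_of_tendsto (hasSum_single_two x) (Eventually.of_forall fun s => ?_)
  refine Submodule.sum_mem _ fun i _ => ?_
  have : (lp.single 2 i (x i) : lp (fun _ : ℕ => ℂ) 2) = x i • lp.single 2 i (1 : ℂ) := by
    rw [← lp.single_smul, smul_eq_mul, mul_one]
  rw [this]
  exact Submodule.smul_mem _ _ (Submodule.subset_span ⟨i, rfl⟩)

theorem stmt_12 (B : lp (fun _ : ℕ => ℂ) 2 →L[ℂ] lp (fun _ : ℕ => ℂ) 2)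
    (hB : ∀ (g : lp (fun _ : ℕ => ℂ) 2) (n : ℕ), (B g : ℕ → ℂ) n = g (n + 1)) :
    ∃ f : lp (fun _ : ℕ => ℂ) 2, ∀ lam : ℝ, 1 < lam →
      Dense (Set.range fun n : ℕ => (((lam : ℂ) • B) ^ n) f) := by
  have hpow (m : ℕ) (x : lp (fun _ : ℕ => ℂ) 2) (n : ℕ) : (B ^ m) x n = x (n + m) := by
    induction m generalizing x with
    | zero => simp
    | succ m ih =>
      rw [pow_succ, mul_apply_eq_comp, ih, hB, add_assoc]
  have := separableSpace_lp_two
  refine exists_common_hypercyclic_vector (S := forwardShift) (fun x => lp.ext ?_)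
    (fun x => (norm_forwardShift x).le) fun x => ?_
  · ext n
    rw [hB]
    rfl
  · refine mem_closure_of_tendsto (hasSum_single_two x).tendsto_sum_nat
      (Eventually.of_forall fun s => ⟨s, lp.ext ?_⟩)
    ext n
    rw [map_sum, lp.coeFn_sum, Finset.sum_apply]
    refine Finset.sum_eq_zero fun i hi => ?_
    rw [hpow, lp.single_apply_ne]
    have := Finset.mem_range.1 hi
    omega
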